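/- Let S be a solution concept that permits bracketing and satisfies expectation-monotonicity and anonymity. Let G_1 be the game in which player 1 has action set {h,ℓ} and every other player has a single action, with payoffs u_1(h,·)=1, u_1(ℓ,·)=0, and u_i ≡ 0 for all i ≠ 1. If there exists p ∈ S(G_1) with p_1(ℓ)=0, then S is a refinement of Nash. -/

import Mathlib

open Filter Topology MeasureTheory

noncomputable section

namespace Paper

/-! ## Lotteries as finitely supported probability mass functions on ℝ -/

open Classical in
/-- The point mass at `a`. -/
def delta {α : Type*} (a : α) : α → ℝ := fun b => if b = a then 1 else 0

/-- `f` is (the p.m.f. of) a finitely supported lottery. -/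
def IsFinLottery (f : ℝ → ℝ) : Prop :=
  (∀ x, 0 ≤ f x) ∧ (Function.support f).Finite ∧ ∑ᶠ x, f x = 1

/-- The CDF of a mass function. -/
def cdfOf (f : ℝ → ℝ) (t : ℝ) : ℝ := ∑ᶠ x, if x ≤ t then f x else 0

/-- Convolution: the distribution of the sum of independent draws. -/
def conv (f g : ℝ → ℝ) : ℝ → ℝ := fun z => ∑ᶠ x, f x * g (z - x)

/-- Expectation of a finitely supported lottery. -/
def expOf (f : ℝ → ℝ) : ℝ := ∑ᶠ x, x * f x

/-- Weak first-order stochastic dominance of `f` over `g`. -/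
def FOSDgeF (f g : ℝ → ℝ) : Prop := ∀ t, cdfOf f t ≤ cdfOf g t

/-- Strict first-order stochastic dominance of `f` over `g`. -/
def FOSDgtF (f g : ℝ → ℝ) : Prop := FOSDgeF f g ∧ f ≠ g

/-- Finitely supported lotteries with rational-valued CDF (`Δ_ℚ`). -/
def IsDeltaQ (f : ℝ → ℝ) : Prop := IsFinLottery f ∧ ∀ t, ∃ q : ℚ, cdfOf f t = (q : ℝ)

/-- Monotone additive statistic on all finitely supported lotteries. -/
def MAS (Φ : (ℝ → ℝ) → ℝ) : Prop :=
  (∀ c : ℝ, Φ (delta c) = c) ∧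
  (∀ f g, IsFinLottery f → IsFinLottery g → Φ (conv f g) = Φ f + Φ g) ∧
  (∀ f g, IsFinLottery f → IsFinLottery g → FOSDgeF f g → Φ g ≤ Φ f)

/-- Monotone additive statistic on `Δ_ℚ`. -/
def MASQ (Φ : (ℝ → ℝ) → ℝ) : Prop :=
  (∀ c : ℝ, Φ (delta c) = c) ∧
  (∀ f g, IsDeltaQ f → IsDeltaQ g → Φ (conv f g) = Φ f + Φ g) ∧
  (∀ f g, IsDeltaQ f → IsDeltaQ g → FOSDgeF f g → Φ g ≤ Φ f)

/-- The statistic `K_a` for `a` in the extended real line. -/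
def Kstat (a : EReal) (f : ℝ → ℝ) : ℝ :=
  if a = ⊤ then sSup (Function.support f)
  else if a = ⊥ then sInf (Function.support f)
  else if a = 0 then expOf f
  else (a.toReal)⁻¹ * Real.log (∑ᶠ x, Real.exp (a.toReal * x) * f x)

/-- `K_a` for real `a`. -/
def Kreal (a : ℝ) : (ℝ → ℝ) → ℝ := Kstat (a : EReal)

/-- The statistic `Φ[X] = ∫ K_a[X] dμ(a)`. -/
def PhiInt (μ : Measure EReal) (f : ℝ → ℝ) : ℝ := ∫ a, Kstat a f ∂μ

/-! ## Finite normal-form games -/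

structure Game (N : ℕ) where
  A : Fin N → Type
  fintypeA : ∀ i, Fintype (A i)
  nonemptyA : ∀ i, Nonempty (A i)
  u : ((i : Fin N) → A i) → Fin N → ℝ

instance {N : ℕ} (G : Game N) (i : Fin N) : Fintype (G.A i) := G.fintypeA i
instance {N : ℕ} (G : Game N) (i : Fin N) : Nonempty (G.A i) := G.nonemptyA i

/-- A (mixed strategy) profile: a real-valued function on each action set. -/
abbrev Profile {N : ℕ} (G : Game N) := (i : Fin N) → G.A i → ℝ

/-- `p` is a mixed strategy profile. -/
def IsMixed {N : ℕ} (G : Game N) (p : Profile G) : Prop :=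
  ∀ i, (∀ ai, 0 ≤ p i ai) ∧ ∑ ai, p i ai = 1

/-- Probability of the full action profile `a` under independent mixing `p`. -/
def weight {N : ℕ} (G : Game N) (p : Profile G) (a : (i : Fin N) → G.A i) : ℝ :=
  ∏ j, p j (a j)

/-- The p.m.f. of player `i`'s payoff lottery `u_i(a_i, p_{-i})`. -/
def payMass {N : ℕ} (G : Game N) (p : Profile G) (i : Fin N) (ai : G.A i) : ℝ → ℝ :=
  fun t => ∑ a : (j : Fin N) → G.A j,
    if G.u a i = t then weight G (Function.update p i (delta ai)) a else 0

/-- Expected payoff `E[u_i(a_i, p_{-i})]`. -/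
def expPay {N : ℕ} (G : Game N) (p : Profile G) (i : Fin N) (ai : G.A i) : ℝ :=
  ∑ a : (j : Fin N) → G.A j, weight G (Function.update p i (delta ai)) a * G.u a i

/-- Expected value of `f` applied to player `i`'s payoff lottery. -/
def expPayOf {N : ℕ} (G : Game N) (p : Profile G) (i : Fin N) (ai : G.A i) (f : ℝ → ℝ) : ℝ :=
  ∑ a : (j : Fin N) → G.A j, weight G (Function.update p i (delta ai)) a * f (G.u a i)

/-- Minimum over `a_{-i}` of `u_i(a_i, a_{-i})`. -/
def minPay {N : ℕ} (G : Game N) (i : Fin N) (ai : G.A i) : ℝ :=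
  ⨅ a : (j : Fin N) → G.A j, G.u (Function.update a i ai) i

/-- Maximum over `a_{-i}` of `u_i(a_i, a_{-i})`. -/
def maxPay {N : ℕ} (G : Game N) (i : Fin N) (ai : G.A i) : ℝ :=
  ⨆ a : (j : Fin N) → G.A j, G.u (Function.update a i ai) i

/-- `a_i` is strictly dominated (by some `b_i`). -/
def StrictlyDominated {N : ℕ} (G : Game N) (i : Fin N) (ai : G.A i) : Prop :=
  ∃ bi : G.A i, ∀ a : (j : Fin N) → G.A j,
    G.u (Function.update a i ai) i < G.u (Function.update a i bi) i

/-! ## Solution concepts and axioms -/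

abbrev SolCon (N : ℕ) := (G : Game N) → Set (Profile G)

/-- A solution concept assigns to each game a nonempty set of mixed strategy profiles. -/
def IsSolutionConcept {N : ℕ} (S : SolCon N) : Prop :=
  ∀ G, (S G).Nonempty ∧ ∀ p ∈ S G, IsMixed G p

/-- The composite game `G ⊗ H`. -/
def Game.comp {N : ℕ} (G H : Game N) : Game N where
  A := fun i => G.A i × H.A i
  fintypeA := fun i => inferInstance
  nonemptyA := fun i => inferInstance
  u := fun c i => G.u (fun j => (c j).1) i + H.u (fun j => (c j).2) i

/-- The product profile `p × q`. -/
def prodProfile {N : ℕ} {G H : Game N} (p : Profile G) (q : Profile H) :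
    Profile (G.comp H) := fun i ab => p i ab.1 * q i ab.2

def Bracketing {N : ℕ} (S : SolCon N) : Prop :=
  ∀ (G H : Game N) (p : Profile G) (q : Profile H),
    p ∈ S G → q ∈ S H → prodProfile p q ∈ S (G.comp H)

/-- The permuted game `G_π`. -/
def Game.permute {N : ℕ} (G : Game N) (π : Equiv.Perm (Fin N)) : Game N where
  A := fun i => G.A (π i)
  fintypeA := fun i => G.fintypeA (π i)
  nonemptyA := fun i => G.nonemptyA (π i)
  u := fun b i =>
    G.u (fun j => cast (congrArg G.A (π.apply_symm_apply j)) (b (π.symm j))) (π i)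

def Anonymity {N : ℕ} (S : SolCon N) : Prop :=
  ∀ (π : Equiv.Perm (Fin N)) (G : Game N) (p : Profile G),
    p ∈ S G → (fun i => p (π i)) ∈ S (G.permute π)

def ExpectationMonotone {N : ℕ} (S : SolCon N) : Prop :=
  ∀ G, ∀ p ∈ S G, ∀ i, ∀ ai bi : G.A i,
    expPay G p i bi < expPay G p i ai → p i bi ≤ p i ai

def ExpectationNeutral {N : ℕ} (S : SolCon N) : Prop :=
  ∀ G, ∀ p ∈ S G, ∀ i, ∀ ai bi : G.A i,
    expPay G p i ai = expPay G p i bi → p i ai = p i bi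

def DistributionMonotone {N : ℕ} (S : SolCon N) : Prop :=
  ∀ G, ∀ p ∈ S G, ∀ i, ∀ ai bi : G.A i,
    FOSDgtF (payMass G p i ai) (payMass G p i bi) → p i bi ≤ p i ai

def Interiority {N : ℕ} (S : SolCon N) : Prop :=
  ∀ G, ∀ p ∈ S G, ∀ i, ∀ ai : G.A i, 0 < p i ai

/-- The game with payoffs rescaled by `α`. -/
def Game.scale {N : ℕ} (G : Game N) (α : ℝ) : Game N :=
  { G with u := fun a i => α * G.u a i }

def ScaleInvariant {N : ℕ} (S : SolCon N) : Prop :=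
  ∀ G : Game N, ∀ p ∈ S G,
    (∀ i, ∀ ai : G.A i, p i ai = ((Fintype.card (G.A i) : ℝ))⁻¹) →
    ∀ α ∈ Set.Ioo (0 : ℝ) 1, p ∈ S (G.scale α)

def StratInvariant {N : ℕ} (S : SolCon N) : Prop :=
  ∀ (G : Game N) (u' : ((i : Fin N) → G.A i) → Fin N → ℝ),
    (∀ i, ∃ w : ((j : Fin N) → G.A j) → ℝ,
      (∀ a, ∀ bi : G.A i, w (Function.update a i bi) = w a) ∧
      (∀ a, u' a i = G.u a i + w a)) →
    S G = S { G with u := u' }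

/-! ## Equilibrium notions -/

def IsNash {N : ℕ} (G : Game N) (p : Profile G) : Prop :=
  ∀ i, ∀ ai : G.A i, 0 < p i ai → ∀ bi : G.A i, expPay G p i bi ≤ expPay G p i ai

def IsLQRE {N : ℕ} (lam : ℝ) (G : Game N) (p : Profile G) : Prop :=
  ∀ i, ∀ ai : G.A i,
    p i ai = Real.exp (lam * expPay G p i ai) / ∑ bi, Real.exp (lam * expPay G p i bi)

def IsNashPhi {N : ℕ} (Φ : (ℝ → ℝ) → ℝ) (G : Game N) (p : Profile G) : Prop :=
  ∀ i, ∀ ai : G.A i, 0 < p i ai → ∀ bi : G.A i,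
    Φ (payMass G p i bi) ≤ Φ (payMass G p i ai)

def IsLQREPhi {N : ℕ} (Φ : (ℝ → ℝ) → ℝ) (lam : ℝ) (G : Game N) (p : Profile G) : Prop :=
  ∀ i, ∀ ai : G.A i,
    p i ai = Real.exp (lam * Φ (payMass G p i ai)) /
      ∑ bi, Real.exp (lam * Φ (payMass G p i bi))

def IsFOSDNash {N : ℕ} (G : Game N) (p : Profile G) : Prop :=
  ∀ i, ∀ ai : G.A i,
    (∃ bi : G.A i, FOSDgtF (payMass G p i bi) (payMass G p i ai)) → p i ai = 0

def IsFOSDQRE {N : ℕ} (G : Game N) (p : Profile G) : Prop :=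
  (∀ i, ∀ ai : G.A i, 0 < p i ai) ∧
  ∀ i, ∀ ai bi : G.A i,
    FOSDgeF (payMass G p i ai) (payMass G p i bi) → p i bi ≤ p i ai

def IsMinMaxMean {N : ℕ} (l1 l2 l3 : ℝ) (G : Game N) (p : Profile G) : Prop :=
  ∀ i, ∀ ai : G.A i,
    p i ai = Real.exp (l1 * minPay G i ai + l2 * expPay G p i ai + l3 * maxPay G i ai) /
      ∑ bi, Real.exp (l1 * minPay G i bi + l2 * expPay G p i bi + l3 * maxPay G i bi)

def CompatibleEU {N : ℕ} (S : SolCon N) : Prop :=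
  ∃ f : ℝ → ℝ, StrictMono f ∧ Continuous f ∧
    ∀ G, ∀ p ∈ S G, ∀ i, ∀ ai bi : G.A i,
      expPayOf G p i bi f < expPayOf G p i ai f → p i bi ≤ p i ai

/-! ## Lotteries as compactly supported probability measures on ℝ -/

/-- Convolution of measures: distribution of the sum of independent draws. -/
def mconv (μ ν : Measure ℝ) : Measure ℝ := (μ.prod ν).map (fun z : ℝ × ℝ => z.1 + z.2)

/-- `npow μ m` is the `m`-fold convolution `μ^m`. -/
def npow (μ : Measure ℝ) : ℕ → Measure ℝ
  | 0 => Measure.dirac 0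
  | n + 1 => mconv (npow μ n) μ

/-- The distribution of `β` times a draw from `μ`. -/
def mscale (β : ℝ) (μ : Measure ℝ) : Measure ℝ := μ.map (fun x => β * x)

/-- `μ` is compactly supported. -/
def CompSupp (μ : Measure ℝ) : Prop := ∃ a b : ℝ, μ (Set.Icc a b)ᶜ = 0

/-- The minimum of the support of `μ`. -/
def minSupp (μ : Measure ℝ) : ℝ := sSup {x : ℝ | μ (Set.Iio x) = 0}

/-- The maximum of the support of `μ`. -/
def maxSupp (μ : Measure ℝ) : ℝ := sInf {x : ℝ | μ (Set.Ioi x) = 0}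

/-- Weak first-order stochastic dominance of `μ` over `ν`. -/
def FOSDgeM (μ ν : Measure ℝ) : Prop := ∀ t, μ (Set.Iic t) ≤ ν (Set.Iic t)

/-- Strict first-order stochastic dominance of `μ` over `ν`. -/
def FOSDgtM (μ ν : Measure ℝ) : Prop := FOSDgeM μ ν ∧ μ ≠ ν

/-- Monotone additive statistic on compactly supported lotteries (as measures). -/
def MASm (Φ : Measure ℝ → ℝ) : Prop :=
  (∀ c : ℝ, Φ (Measure.dirac c) = c) ∧
  (∀ μ ν : Measure ℝ, IsProbabilityMeasure μ → IsProbabilityMeasure ν →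
    CompSupp μ → CompSupp ν → Φ (mconv μ ν) = Φ μ + Φ ν) ∧
  (∀ μ ν : Measure ℝ, IsProbabilityMeasure μ → IsProbabilityMeasure ν →
    CompSupp μ → CompSupp ν → FOSDgeM μ ν → Φ ν ≤ Φ μ)

/-! ## Two-player games, unbundled -/

/-- `p` is a probability distribution on the finite type `α`. -/
def IsDist {α : Type*} [Fintype α] (p : α → ℝ) : Prop :=
  (∀ a, 0 ≤ p a) ∧ ∑ a, p a = 1

/-- Payoff lottery of player 1 playing `a` against the mixed strategy `q`. -/
def mass1 {α β : Type*} [Fintype β] (u : α → β → ℝ) (q : β → ℝ) (a : α) : ℝ → ℝ :=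
  fun t => ∑ b, if u a b = t then q b else 0

/-- Payoff lottery of player 2 playing `b` against the mixed strategy `p`. -/
def mass2 {α β : Type*} [Fintype α] (u : α → β → ℝ) (p : α → ℝ) (b : β) : ℝ → ℝ :=
  fun t => ∑ a, if u a b = t then p a else 0

/-- The distribution of a random variable on the uniform space `{1,…,m}`. -/
def distOf {m : ℕ} (X : Fin m → ℝ) : ℝ → ℝ :=
  fun t => (∑ ω : Fin m, if X ω = t then (1 : ℝ) else 0) / m


/-- Player 1 (index `0`) of `N ≥ 2` players. -/
def player0 {N : ℕ} (hN : 2 ≤ N) : Fin N := ⟨0, by omega⟩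

/-- The test game `G_x`: player 1 chooses between `h = true` (payoff `x`) and
`ℓ = false` (payoff `0`); every other player has a single action; all other
payoffs are `0`. -/
def testGame {N : ℕ} (hN : 2 ≤ N) (x : ℝ) : Game N where
  A := fun i => if i = player0 hN then Bool else PUnit
  fintypeA := fun i => by
    show Fintype (if i = player0 hN then Bool else PUnit)
    split <;> infer_instance
  nonemptyA := fun i => by
    show Nonempty (if i = player0 hN then Bool else PUnit)
    split <;> infer_instance
  u := fun a i =>
    if i = player0 hN then
      (if (cast (if_pos rfl :
            (if player0 hN = player0 hN then Bool else PUnit) = Bool)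
            (a (player0 hN)) : Bool) then x else 0)
    else 0

/-- The action `ℓ` of player 1 in the test game. -/
def actL {N : ℕ} (hN : 2 ≤ N) (x : ℝ) : (testGame hN x).A (player0 hN) :=
  cast (if_pos rfl :
    (if player0 hN = player0 hN then Bool else PUnit) = Bool).symm false

/-- The weights of a mixed profile sum to one. -/
theorem sum_weight {N : ℕ} {G : Game N} {p : Profile G} (hp : IsMixed G p) :
    ∑ a, weight G p a = 1 := by
  unfold weight
  rw [← Fintype.piFinset_univ, ← Finset.prod_univ_sum]
  exact Finset.prod_eq_one fun i _ => (hp i).2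

theorem IsMixed.update_delta {N : ℕ} {G : Game N} {p : Profile G} (hp : IsMixed G p)
    (i : Fin N) (a : G.A i) : IsMixed G (Function.update p i (delta a)) := by
  intro j
  by_cases h : j = i
  · subst h
    simp only [Function.update_self, delta]
    refine ⟨fun b => ?_, by rw [Fintype.sum_eq_single a fun b hb => if_neg hb, if_pos rfl]⟩
    split_ifs <;> norm_num
  · simpa only [Function.update_of_ne h] using hp j

theorem delta_prodMk {α β : Type*} (a x : α) (b y : β) :
    delta (a, b) (x, y) = delta a x * delta b y := by
  by_cases h₁ : x = a <;> by_cases h₂ : y = b <;> simp [delta, h₁, h₂]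

theorem prodProfile_update_delta {N : ℕ} {G H : Game N} (p : Profile G) (q : Profile H)
    (i : Fin N) (a : G.A i) (b : H.A i) :
    Function.update (prodProfile p q) i (delta ((a, b) : G.A i × H.A i)) =
      prodProfile (Function.update p i (delta a)) (Function.update q i (delta b)) := by
  funext j c
  obtain ⟨x, y⟩ := c
  by_cases h : j = i
  · subst h
    simp only [Function.update_self, prodProfile]
    exact delta_prodMk a x b y
  · simp [prodProfile, Function.update_of_ne h]

/-- Expected payoffs add up over the components of a composite game. -/
theorem expPay_comp {N : ℕ} {G H : Game N} {p : Profile G} {q : Profile H}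
    (hp : IsMixed G p) (hq : IsMixed H q) (i : Fin N) (a : G.A i) (b : H.A i) :
    expPay (G.comp H) (prodProfile p q) i (a, b) = expPay G p i a + expPay H q i b := by
  have hp' := sum_weight (hp.update_delta i a)
  have hq' := sum_weight (hq.update_delta i b)
  unfold expPay
  rw [prodProfile_update_delta]
  generalize Function.update p i (delta a) = P at *
  generalize Function.update q i (delta b) = Q at *
  let e : (∀ j, (G.comp H).A j) ≃ (∀ j, G.A j) × (∀ j, H.A j) :=
    { toFun := fun c => (fun j => (c j).1, fun j => (c j).2)
      invFun := fun c j => (c.1 j, c.2 j)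
      left_inv := fun _ => rfl
      right_inv := fun _ => rfl }
  calc
    _ = ∑ c : (∀ j, G.A j) × (∀ j, H.A j),
        weight G P c.1 * weight H Q c.2 * (G.u c.1 i + H.u c.2 i) := by
      refine Fintype.sum_equiv e _ _ fun c => ?_
      have hw : weight (G.comp H) (prodProfile P Q) c =
          weight G P (e c).1 * weight H Q (e c).2 := Finset.prod_mul_distrib
      rw [hw]
      rfl
    _ = (∑ x, weight G P x * G.u x i) * (∑ y, weight H Q y) +
        (∑ x, weight G P x) * (∑ y, weight H Q y * H.u y i) := by
      rw [Fintype.sum_prod_type, Finset.sum_mul_sum, Finset.sum_mul_sum,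
        ← Finset.sum_add_distrib]
      refine Finset.sum_congr rfl fun x _ => ?_
      rw [← Finset.sum_add_distrib]
      exact Finset.sum_congr rfl fun y _ => by ring
    _ = _ := by rw [hp', hq', mul_one, one_mul]

/-- If player `i`'s payoff is constant on the profiles where `i` plays `x`, then the expected
payoff of `x` is that constant. -/
theorem expPay_eq_of_forall {N : ℕ} {G : Game N} {p : Profile G} (hp : IsMixed G p)
    {i : Fin N} {x : G.A i} {c : ℝ} (h : ∀ a, a i = x → G.u a i = c) :
    expPay G p i x = c := by
  have hs := sum_weight (hp.update_delta i x)
  unfold expPay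
  rw [← one_mul c, ← hs, Finset.sum_mul]
  refine Finset.sum_congr rfl fun a _ => ?_
  by_cases ha : a i = x
  · rw [h a ha]
  · have h0 : weight G (Function.update p i (delta x)) a = 0 :=
      Finset.prod_eq_zero (Finset.mem_univ i) (by simp [delta, ha])
    rw [h0, zero_mul, zero_mul]

theorem Game.permute_u_eq_of_forall {N : ℕ} {G : Game N} (π : Equiv.Perm (Fin N)) (i : Fin N)
    {x : G.A (π i)} {c : ℝ} (h : ∀ a, a (π i) = x → G.u a (π i) = c)
    (b : ∀ j, (G.permute π).A j) (hb : b i = x) : (G.permute π).u b i = c := by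
  refine h _ (eq_of_heq ((cast_heq _ _).trans ?_))
  rw [← hb, π.symm_apply_apply]
  rfl

/-- For every player there is a game with a solution that never plays `x`, plays `y` with
positive probability, and in which `y` yields exactly one more than `x`. -/
theorem exists_solution_dominated_action {N : ℕ} (hN : 2 ≤ N) {S : SolCon N}
    (hS : IsSolutionConcept S) (hAn : Anonymity S)
    (hp : ∃ p ∈ S (testGame hN 1), p (player0 hN) (actL hN 1) = 0) (i : Fin N) :
    ∃ G : Game N, ∃ p ∈ S G, ∃ x y : G.A i,
      p i x = 0 ∧ 0 < p i y ∧ expPay G p i y = expPay G p i x + 1 := by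
  obtain ⟨p, hpS, hp0⟩ := hp
  have hpm := (hS _).2 p hpS
  obtain ⟨y, hy⟩ : ∃ y, 0 < p (player0 hN) y := by
    by_contra! h
    have := (hpm (player0 hN)).2 ▸ Finset.sum_nonpos fun y _ => h y
    linarith
  have hyL : y ≠ actL hN 1 := fun h => by rw [h, hp0] at hy; exact lt_irrefl _ hy
  have hux : ∀ a, a (player0 hN) = actL hN 1 → (testGame hN 1).u a (player0 hN) = 0 := by
    intro a ha
    simp only [testGame, if_true]
    rw [ha, if_neg]
    rw [Bool.not_eq_true]
    exact eq_of_heq ((cast_heq _ _).trans (cast_heq _ _))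
  have huy : ∀ a, a (player0 hN) = y → (testGame hN 1).u a (player0 hN) = 1 := by
    intro a ha
    simp only [testGame, if_true]
    rw [ha, if_pos]
    by_contra hf
    rw [Bool.not_eq_true] at hf
    exact hyL (eq_of_heq ((cast_heq _ _).symm.trans
      ((heq_of_eq hf).trans (cast_heq _ _).symm)))
  generalize actL hN 1 = x at *
  generalize testGame hN 1 = G at *
  obtain ⟨π, hπ⟩ : ∃ π : Equiv.Perm (Fin N), π i = player0 hN :=
    ⟨Equiv.swap i (player0 hN), Equiv.swap_apply_left _ _⟩
  generalize player0 hN = j at *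
  subst hπ
  have hqS := hAn π G p hpS
  have hqm := (hS _).2 _ hqS
  refine ⟨G.permute π, _, hqS, x, y, hp0, hy, ?_⟩
  rw [expPay_eq_of_forall hqm (Game.permute_u_eq_of_forall π i hux),
    expPay_eq_of_forall hqm (Game.permute_u_eq_of_forall π i huy), zero_add]

/-- if some solution of the test game `G_1` plays the dominated action
`ℓ` with probability zero, then `S` refines Nash. -/
theorem stmt10 {N : ℕ} (hN : 2 ≤ N) (S : SolCon N) (hS : IsSolutionConcept S)
    (hBr : Bracketing S) (hEM : ExpectationMonotone S) (hAn : Anonymity S)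
    (hp : ∃ p ∈ S (testGame hN 1), p (player0 hN) (actL hN 1) = 0) :
    ∀ G, ∀ p ∈ S G, IsNash G p := by
  intro G p hpS i a ha b
  by_contra! hlt
  have hpm := (hS G).2 p hpS
  have key : ∀ n : ℕ, ∃ H : Game N, ∃ q ∈ S H, ∃ x y : H.A i, q i x = 0 ∧ 0 < q i y ∧
      expPay H q i y = expPay H q i x + 1 - n * (expPay G p i b - expPay G p i a) := by
    intro n
    induction n with
    | zero => simpa using exists_solution_dominated_action hN hS hAn hp i
    | succ n ih =>
      obtain ⟨H, q, hqS, x, y, hx, hy, hE⟩ := ih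
      have hqm := (hS H).2 q hqS
      refine ⟨H.comp G, prodProfile q p, hBr _ _ _ _ hqS hpS, (x, b), (y, a), ?_, ?_, ?_⟩
      · simp [prodProfile, hx]
      · exact mul_pos hy ha
      · rw [expPay_comp hqm hpm, expPay_comp hqm hpm, hE]
        push_cast
        ring
  obtain ⟨n, hn⟩ := exists_nat_gt (1 / (expPay G p i b - expPay G p i a))
  rw [div_lt_iff₀ (sub_pos.2 hlt)] at hn
  obtain ⟨H, q, hqS, x, y, hx, hy, hE⟩ := key n
  have := hEM H q hqS i x y (by linarith)
  linarith

end Paper
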